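/- Let D = ker α∧β be an Engel structure with a choice of Engel defining forms, and let g be a Riemannian metric such that D^⊥ = R (the Reeb distribution). If D is totally geodesic, then there exists a nowhere-vanishing function μ ∈ C^∞(M) such that β̃ = μβ satisfies dβ̃ ∧ dβ̃ = 0. In particular, the Reeb distribution R̃ associated with the Engel defining forms α and β̃ is integrable. -/

import Mathlib

noncomputable section

open Manifold Module Function Set

variable {E : Type*} [NormedAddCommGroup E] [NormedSpace ℝ E]
  {H : Type*} [TopologicalSpace H]

/-- The type of (not necessarily smooth) vector fields on a manifold. -/
abbrev VF (I : ModelWithCorners ℝ E H) (M : Type*) [TopologicalSpace M] [ChartedSpace H M] :=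
  ∀ x : M, TangentSpace I x

/-- A vector field is smooth if the corresponding section of the tangent bundle is smooth. -/
def SmoothVF (I : ModelWithCorners ℝ E H) {M : Type*} [TopologicalSpace M] [ChartedSpace H M]
    [IsManifold I (⊤ : ℕ∞) M] (V : VF I M) : Prop :=
  ContMDiff I I.tangent (⊤ : ℕ∞) (fun x => (⟨x, V x⟩ : TangentBundle I M))

/-- A smooth real valued function on a manifold. -/
def SmoothFn (I : ModelWithCorners ℝ E H) {M : Type*} [TopologicalSpace M] [ChartedSpace H M]
    [IsManifold I (⊤ : ℕ∞) M] (f : M → ℝ) : Prop :=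
  ContMDiff I 𝓘(ℝ) (⊤ : ℕ∞) f

/-- Derivative of a real valued function along a vector field. -/
def vderiv (I : ModelWithCorners ℝ E H) {M : Type*} [TopologicalSpace M] [ChartedSpace H M]
    [IsManifold I (⊤ : ℕ∞) M] (V : VF I M) (f : M → ℝ) : M → ℝ :=
  fun x => mfderiv I 𝓘(ℝ) f x (V x)

/-- The Lie bracket of two vector fields on a manifold, defined by transporting the two
vector fields to the model space via the preferred chart at the given point, taking the
Lie bracket of vector fields there, and transporting the result back.  For smooth vector
fields this is the usual Lie bracket `[V, W]`. -/
def vfLie (I : ModelWithCorners ℝ E H) {M : Type*} [TopologicalSpace M] [ChartedSpace H M]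
    [IsManifold I (⊤ : ℕ∞) M] (V W : VF I M) : VF I M := fun x₀ =>
  mfderiv 𝓘(ℝ, E) I (extChartAt I x₀).symm (extChartAt I x₀ x₀)
    ((VectorField.lieBracket ℝ
      (fun e => (mfderiv I 𝓘(ℝ, E) (extChartAt I x₀) ((extChartAt I x₀).symm e)
        (V ((extChartAt I x₀).symm e)) : E))
      (fun e => (mfderiv I 𝓘(ℝ, E) (extChartAt I x₀) ((extChartAt I x₀).symm e)
        (W ((extChartAt I x₀).symm e)) : E))
      (extChartAt I x₀ x₀) : E))

/-- A smooth differential `1`-form on a manifold, given by its pointwise values. -/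
structure OneForm (I : ModelWithCorners ℝ E H) (M : Type*) [TopologicalSpace M]
    [ChartedSpace H M] [IsManifold I (⊤ : ℕ∞) M] where
  val : ∀ x : M, TangentSpace I x →ₗ[ℝ] ℝ
  smooth' : ∀ V : VF I M, SmoothVF I V → SmoothFn I (fun x => val x (V x))

/-- A smooth differential `k`-form on a manifold, given by its pointwise values. -/
structure FormPt (I : ModelWithCorners ℝ E H) (M : Type*) [TopologicalSpace M]
    [ChartedSpace H M] [IsManifold I (⊤ : ℕ∞) M] (k : ℕ) where
  val : ∀ x : M, (TangentSpace I x) [⋀^Fin k]→ₗ[ℝ] ℝ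
  smooth' : ∀ V : Fin k → VF I M, (∀ i, SmoothVF I (V i)) →
    SmoothFn I (fun x => val x (fun i => V i x))

variable {I : ModelWithCorners ℝ E H} {M : Type*} [TopologicalSpace M] [ChartedSpace H M]
  [IsManifold I (⊤ : ℕ∞) M]

/-- The exterior derivative of a (pointwise defined) `1`-form, evaluated on two vector
fields, via the Cartan formula `dω(V,W) = V (ω W) - W (ω V) - ω [V,W]`.  Here the `1`-form
is given as a function on vector fields. -/
def dOfFun (I : ModelWithCorners ℝ E H) {M : Type*} [TopologicalSpace M] [ChartedSpace H M]
    [IsManifold I (⊤ : ℕ∞) M] (lam : VF I M → M → ℝ) (V W : VF I M) : M → ℝ :=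
  fun x => vderiv I V (lam W) x - vderiv I W (lam V) x - lam (vfLie I V W) x

/-- The exterior derivative of a `1`-form, as a function of two vector fields. -/
def OneForm.d (ω : OneForm I M) (V W : VF I M) : M → ℝ :=
  dOfFun I (fun U x => ω.val x (U x)) V W

/-- A distribution (field of tangent subspaces) on a manifold. -/
abbrev TangentDist (I : ModelWithCorners ℝ E H) (M : Type*) [TopologicalSpace M] [ChartedSpace H M] :=
  ∀ x : M, Submodule ℝ (TangentSpace I x)

/-- A (smooth) section of a distribution. -/
def IsSection (I : ModelWithCorners ℝ E H) {M : Type*} [TopologicalSpace M] [ChartedSpace H M]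
    [IsManifold I (⊤ : ℕ∞) M] (D : TangentDist I M) (V : VF I M) : Prop :=
  SmoothVF I V ∧ ∀ x, V x ∈ D x

/-- The distribution `[D, D]` generated by a distribution `D` together with all Lie brackets
of its sections. -/
def derivedDist (I : ModelWithCorners ℝ E H) {M : Type*} [TopologicalSpace M] [ChartedSpace H M]
    [IsManifold I (⊤ : ℕ∞) M] (D : TangentDist I M) : TangentDist I M := fun x =>
  Submodule.span ℝ
    ({v | ∃ V, IsSection I D V ∧ V x = v} ∪
     {v | ∃ V W, IsSection I D V ∧ IsSection I D W ∧ vfLie I V W x = v})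

/-- A distribution is integrable (in the sense of Frobenius: involutive) if Lie brackets of
its sections are again tangent to it. -/
def IsIntegrableDist (I : ModelWithCorners ℝ E H) {M : Type*} [TopologicalSpace M]
    [ChartedSpace H M] [IsManifold I (⊤ : ℕ∞) M] (D : TangentDist I M) : Prop :=
  ∀ V W, IsSection I D V → IsSection I D W → ∀ x, vfLie I V W x ∈ D x

/-- `(ω ∧ θ)(U,V,W)` for a `1`-form `ω` and a `2`-form `θ` given as a function of two
vector fields. -/
def wedge1_2 (I : ModelWithCorners ℝ E H) {M : Type*} [TopologicalSpace M] [ChartedSpace H M]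
    [IsManifold I (⊤ : ℕ∞) M] (ω : OneForm I M) (θ : VF I M → VF I M → M → ℝ)
    (U V W : VF I M) : M → ℝ := fun x =>
  ω.val x (U x) * θ V W x - ω.val x (V x) * θ U W x + ω.val x (W x) * θ U V x

/-- The square `θ ∧ θ` of a `2`-form `θ` (given as a function of two vector fields) vanishes
identically. -/
def FormSqZero (I : ModelWithCorners ℝ E H) {M : Type*} [TopologicalSpace M] [ChartedSpace H M]
    [IsManifold I (⊤ : ℕ∞) M] (θ : VF I M → VF I M → M → ℝ) : Prop :=
  ∀ V₀ V₁ V₂ V₃ : VF I M, SmoothVF I V₀ → SmoothVF I V₁ → SmoothVF I V₂ → SmoothVF I V₃ →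
    ∀ x, θ V₀ V₁ x * θ V₂ V₃ x - θ V₀ V₂ x * θ V₁ V₃ x + θ V₀ V₃ x * θ V₁ V₂ x = 0

/-- An Engel structure: a rank 2 distribution `D` such that `E := [D,D]` has rank 3 and
`[E,E] = TM`. -/
def IsEngel (I : ModelWithCorners ℝ E H) {M : Type*} [TopologicalSpace M] [ChartedSpace H M]
    [IsManifold I (⊤ : ℕ∞) M] (D : TangentDist I M) : Prop :=
  (∀ x, Module.finrank ℝ (D x) = 2) ∧ (∀ x, Module.finrank ℝ (derivedDist I D x) = 3) ∧
  (∀ x, derivedDist I (derivedDist I D) x = ⊤)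

/-- Engel defining forms: `D = ker α ∩ ker β` and `E = [D,D] = ker α`. -/
def EngelDefiningForms (I : ModelWithCorners ℝ E H) {M : Type*} [TopologicalSpace M]
    [ChartedSpace H M] [IsManifold I (⊤ : ℕ∞) M] (D : TangentDist I M)
    (α β : OneForm I M) : Prop :=
  (∀ x, D x = LinearMap.ker (α.val x) ⊓ LinearMap.ker (β.val x)) ∧
  (∀ x, derivedDist I D x = LinearMap.ker (α.val x))

/-- The pair of Reeb vector fields `T`, `R` associated with Engel defining forms `α`, `β`:
`i_T(α ∧ dβ) = 0`, `β(T) = 1`, `α(T) = 0`, `i_R(β ∧ dβ) = 0`, `β(R) = 0`, `α(R) = 1`. -/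
structure IsReebPair (I : ModelWithCorners ℝ E H) {M : Type*} [TopologicalSpace M]
    [ChartedSpace H M] [IsManifold I (⊤ : ℕ∞) M] (α β : OneForm I M)
    (T R : VF I M) : Prop where
  smoothT : SmoothVF I T
  smoothR : SmoothVF I R
  alphaT : ∀ x, α.val x (T x) = 0
  betaT : ∀ x, β.val x (T x) = 1
  alphaR : ∀ x, α.val x (R x) = 1
  betaR : ∀ x, β.val x (R x) = 0
  insT : ∀ V W, SmoothVF I V → SmoothVF I W → ∀ x, wedge1_2 I α β.d T V W x = 0
  insR : ∀ V W, SmoothVF I V → SmoothVF I W → ∀ x, wedge1_2 I β β.d R V W x = 0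

/-- The Reeb distribution spanned by the two Reeb vector fields. -/
def reebDist (I : ModelWithCorners ℝ E H) {M : Type*} [TopologicalSpace M] [ChartedSpace H M]
    (T R : VF I M) : TangentDist I M := fun x => Submodule.span ℝ {T x, R x}

/-- `W` is a nonsingular vector field spanning the characteristic foliation of the even
contact structure `E = [D,D]`:  `W` is tangent to `D` and `[W, E] ⊆ E`. -/
def SpansChar (I : ModelWithCorners ℝ E H) {M : Type*} [TopologicalSpace M] [ChartedSpace H M]
    [IsManifold I (⊤ : ℕ∞) M] (D : TangentDist I M) (W : VF I M) : Prop :=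
  SmoothVF I W ∧ (∀ x, W x ≠ 0) ∧ (∀ x, W x ∈ D x) ∧
  ∀ V, IsSection I (derivedDist I D) V → ∀ x, vfLie I W V x ∈ derivedDist I D x

/-- A Riemannian metric, given by its pointwise values. -/
structure RMetric (I : ModelWithCorners ℝ E H) (M : Type*) [TopologicalSpace M]
    [ChartedSpace H M] [IsManifold I (⊤ : ℕ∞) M] where
  val : ∀ x : M, TangentSpace I x →ₗ[ℝ] TangentSpace I x →ₗ[ℝ] ℝ
  symm : ∀ x u v, val x u v = val x v u
  posdef : ∀ x v, v ≠ 0 → 0 < val x v v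
  smooth' : ∀ V W, SmoothVF I V → SmoothVF I W → SmoothFn I (fun x => val x (V x) (W x))

/-- The Koszul formula: `koszul g X Y Z = g(∇_X Y, Z)` where `∇` is the Levi-Civita
connection of `g`. -/
def koszul (I : ModelWithCorners ℝ E H) {M : Type*} [TopologicalSpace M] [ChartedSpace H M]
    [IsManifold I (⊤ : ℕ∞) M] (g : RMetric I M) (X Y Z : VF I M) : M → ℝ := fun x =>
  (vderiv I X (fun y => g.val y (Y y) (Z y)) x + vderiv I Y (fun y => g.val y (X y) (Z y)) x
    - vderiv I Z (fun y => g.val y (X y) (Y y)) x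
    + g.val x (vfLie I X Y x) (Z x) - g.val x (vfLie I X Z x) (Y x)
    - g.val x (vfLie I Y Z x) (X x)) / 2

/-- A distribution `D` is totally geodesic for `g` iff every geodesic tangent to it at one
point stays tangent to it; equivalently (the standard characterization, which we take as the
definition) `∇_U U` is tangent to `D` for every section `U` of `D`, i.e. `g(∇_U U, V) = 0`
for every vector field `V` orthogonal to `D`. -/
def IsTotallyGeodesic (I : ModelWithCorners ℝ E H) {M : Type*} [TopologicalSpace M]
    [ChartedSpace H M] [IsManifold I (⊤ : ℕ∞) M] (g : RMetric I M)
    (D : TangentDist I M) : Prop :=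
  ∀ U, IsSection I D U → ∀ V, SmoothVF I V → (∀ x, ∀ u ∈ D x, g.val x (V x) u = 0) →
    ∀ x, koszul I g U U V x = 0

/-- A Killing vector field: `L_Z g = 0`, expressed on vector fields. -/
def IsKilling (I : ModelWithCorners ℝ E H) {M : Type*} [TopologicalSpace M] [ChartedSpace H M]
    [IsManifold I (⊤ : ℕ∞) M] (g : RMetric I M) (Z : VF I M) : Prop :=
  ∀ V W, SmoothVF I V → SmoothVF I W → ∀ x,
    vderiv I Z (fun y => g.val y (V y) (W y)) x
      = g.val x (vfLie I Z V x) (W x) + g.val x (V x) (vfLie I Z W x)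

/-- An Engel vector field: the flow of `Z` preserves `D`, i.e. `L_Z D ⊆ D`. -/
def IsEngelVF (I : ModelWithCorners ℝ E H) {M : Type*} [TopologicalSpace M] [ChartedSpace H M]
    [IsManifold I (⊤ : ℕ∞) M] (D : TangentDist I M) (Z : VF I M) : Prop :=
  SmoothVF I Z ∧ ∀ V, IsSection I D V → ∀ x, vfLie I Z V x ∈ D x

/-- A K-Engel structure: `D` is an Engel structure, `g` a Riemannian metric and `Z` a
(nowhere vanishing) vector field which is Engel, Killing and orthogonal to `E = [D,D]`. -/
structure IsKEngel (I : ModelWithCorners ℝ E H) {M : Type*} [TopologicalSpace M]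
    [ChartedSpace H M] [IsManifold I (⊤ : ℕ∞) M] (D : TangentDist I M)
    (g : RMetric I M) (Z : VF I M) : Prop where
  engel : IsEngel I D
  engelVF : IsEngelVF I D Z
  killing : IsKilling I g Z
  orth : ∀ x, ∀ v ∈ derivedDist I D x, g.val x (Z x) v = 0
  nonzero : ∀ x, Z x ≠ 0

/-- A `1`-form is closed. -/
def OneForm.IsClosed {I : ModelWithCorners ℝ E H} {M : Type*} [TopologicalSpace M]
    [ChartedSpace H M] [IsManifold I (⊤ : ℕ∞) M] (ω : OneForm I M) : Prop :=
  ∀ V W, SmoothVF I V → SmoothVF I W → ∀ x, ω.d V W x = 0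

/-- The Lie derivative `(L_Z ω)(V) = Z (ω V) - ω [Z,V]` of a `1`-form along a vector
field, as a function of vector fields. -/
def lieOneForm (I : ModelWithCorners ℝ E H) {M : Type*} [TopologicalSpace M] [ChartedSpace H M]
    [IsManifold I (⊤ : ℕ∞) M] (ω : OneForm I M) (Z V : VF I M) : M → ℝ := fun x =>
  vderiv I Z (fun y => ω.val y (V y)) x - ω.val x (vfLie I Z V x)

/-- The exterior derivative of a pointwise-defined `(m+1)`-form evaluated on `m+2` vector
fields, via the global Koszul formula. -/
def extDerEval (I : ModelWithCorners ℝ E H) {M : Type*} [TopologicalSpace M] [ChartedSpace H M]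
    [IsManifold I (⊤ : ℕ∞) M] {m : ℕ} (ν : FormPt I M (m+1)) (V : Fin (m+2) → VF I M) :
    M → ℝ := fun x =>
  (∑ i : Fin (m+2), (-1 : ℝ)^(i : ℕ) *
    vderiv I (V i) (fun y => ν.val y (fun l => V (i.succAbove l) y)) x)
  + ∑ i : Fin (m+2), ∑ j : Fin (m+2), if h : (i : ℕ) < (j : ℕ) then
      (-1 : ℝ)^((i : ℕ)+(j : ℕ)) * ν.val x (Fin.cons (vfLie I (V i) (V j) x)
        (fun l => V (j.succAbove ((⟨(i : ℕ), by have := j.2; omega⟩ : Fin (m+1)).succAbove l)) x))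
    else 0

/-- A pointwise-defined form is closed. -/
def FormPt.IsClosedForm {I : ModelWithCorners ℝ E H} {M : Type*} [TopologicalSpace M]
    [ChartedSpace H M] [IsManifold I (⊤ : ℕ∞) M] {m : ℕ} (ν : FormPt I M (m+1)) : Prop :=
  ∀ V : Fin (m+2) → VF I M, (∀ i, SmoothVF I (V i)) → ∀ x, extDerEval I ν V x = 0

/-- `φ : ℝ → M → M` is the flow of the vector field `Z`. -/
def IsFlowOf (I : ModelWithCorners ℝ E H) {M : Type*} [TopologicalSpace M] [ChartedSpace H M]
    [IsManifold I (⊤ : ℕ∞) M] (Z : VF I M) (φ : ℝ → M → M) : Prop :=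
  Continuous (fun p : ℝ × M => φ p.1 p.2) ∧ (∀ x, φ 0 x = x) ∧
  (∀ s t x, φ (s + t) x = φ s (φ t x)) ∧
  ∀ x t, HasMFDerivAt 𝓘(ℝ) I (fun s => φ s x) t
    ((1 : ℝ →L[ℝ] ℝ).smulRight (Z (φ t x)))

/-- `(η ∧ dη ∧ dη)(V₀,...,V₄)` up to a positive constant factor, for a pointwise `1`-form
`η`; pointwise nonvanishing of this expression on frames is the contact condition in
dimension 5. -/
def contactEval (I : ModelWithCorners ℝ E H) {M : Type*} [TopologicalSpace M] [ChartedSpace H M]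
    [IsManifold I (⊤ : ℕ∞) M] (η : ∀ z : M, TangentSpace I z →ₗ[ℝ] ℝ)
    (V : Fin 5 → VF I M) : M → ℝ := fun z =>
  ∑ σ : Equiv.Perm (Fin 5), ((Equiv.Perm.sign σ : ℤ) : ℝ) *
    (η z (V (σ 0) z) * dOfFun I (fun U x => η x (U x)) (V (σ 1)) (V (σ 2)) z *
      dOfFun I (fun U x => η x (U x)) (V (σ 3)) (V (σ 4)) z)

section LieBracket

open VectorField Filter
open scoped Topology ContDiff

theorem SmoothFn.mdifferentiableAt {f : M → ℝ} (hf : SmoothFn I f) (x : M) :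
    MDifferentiableAt I 𝓘(ℝ) f x :=
  ContMDiff.mdifferentiableAt hf (by simp)

theorem SmoothVF.mdifferentiableAt {V : VF I M} (hV : SmoothVF I V) (x : M) :
    MDifferentiableAt I I.tangent (fun y => (⟨y, V y⟩ : TangentBundle I M)) x :=
  ContMDiff.mdifferentiableAt hV (by simp)

theorem SmoothVF.add {V W : VF I M} (hV : SmoothVF I V) (hW : SmoothVF I W) :
    SmoothVF I (V + W) := ContMDiff.add_section hV hW

theorem SmoothVF.smul {f : M → ℝ} {V : VF I M} (hf : SmoothFn I f) (hV : SmoothVF I V) :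
    SmoothVF I (f • V) := ContMDiff.smul_section hf hV

theorem SmoothVF.sub {V W : VF I M} (hV : SmoothVF I V) (hW : SmoothVF I W) :
    SmoothVF I (V - W) := ContMDiff.sub_section hV hW

theorem SmoothFn.vderiv {V : VF I M} {f : M → ℝ} (hV : SmoothVF I V) (hf : SmoothFn I f) :
    SmoothFn I (vderiv I V f) := by
  have h := (ContMDiff.contMDiff_tangentMap (m := ∞) hf (by simp)).comp hV
  exact (contMDiff_snd_tangentBundle_modelSpace ℝ 𝓘(ℝ)).comp h

/-- The derivative of a function along `v`, read in the chart at `x`. -/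
theorem fderiv_comp_extChartAt_symm_mfderiv [I.Boundaryless] {x y : M} {h : M → ℝ}
    (hh : MDifferentiableAt I 𝓘(ℝ) h y) (hy : y ∈ (extChartAt I x).source)
    (v : TangentSpace I y) :
    fderiv ℝ (h ∘ (extChartAt I x).symm) (extChartAt I x y)
      (mfderiv I 𝓘(ℝ, E) (extChartAt I x) y v) = mfderiv I 𝓘(ℝ) h y v := by
  have hs : MDifferentiableAt 𝓘(ℝ, E) I (extChartAt I x).symm (extChartAt I x y) := by
    have := mdifferentiableWithinAt_extChartAt_symm (I := I) ((extChartAt I x).map_source hy)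
    rwa [I.range_eq_univ, mdifferentiableWithinAt_univ] at this
  have hc : MDifferentiableAt I 𝓘(ℝ, E) (extChartAt I x) y :=
    mdifferentiableAt_extChartAt (by rwa [← extChartAt_source I])
  have hg : MDifferentiableAt 𝓘(ℝ, E) 𝓘(ℝ) (h ∘ (extChartAt I x).symm) (extChartAt I x y) := by
    refine MDifferentiableAt.comp _ ?_ hs
    rwa [(extChartAt I x).left_inv hy]
  have hEq : (h ∘ (extChartAt I x).symm) ∘ extChartAt I x =ᶠ[𝓝 y] h := by
    filter_upwards [(isOpen_extChartAt_source (I := I) x).mem_nhds hy] with z hz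
    simp only [Function.comp_apply, (extChartAt I x).left_inv hz]
  have h1 := hEq.mfderiv_eq (I := I) (I' := 𝓘(ℝ))
  rw [mfderiv_comp y hg hc] at h1
  have h2 := congrArg (fun L => L v) h1
  rw [← mfderiv_eq_fderiv]
  exact h2

/-- A vector field read in the chart at `x₀`. -/
abbrev chartField (I : ModelWithCorners ℝ E H) {M : Type*} [TopologicalSpace M] [ChartedSpace H M]
    (x₀ : M) (V : VF I M) : E → E := fun e =>
  mfderiv I 𝓘(ℝ, E) (extChartAt I x₀) ((extChartAt I x₀).symm e) (V ((extChartAt I x₀).symm e))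

theorem chartField_eventuallyEq_mpullback [I.Boundaryless] (x₀ : M) (V : VF I M) :
    chartField I x₀ V =ᶠ[𝓝 (extChartAt I x₀ x₀)]
      mpullbackWithin 𝓘(ℝ, E) I (extChartAt I x₀).symm V (range I) := by
  filter_upwards [(isOpen_extChartAt_target (I := I) x₀).mem_nhds (mem_extChartAt_target x₀)]
    with e he
  have h1 := mfderiv_extChartAt_comp_mfderivWithin_extChartAt_symm (I := I) he
  have h2 := mfderivWithin_extChartAt_symm_comp_mfderiv_extChartAt (I := I) he
  rw [mpullbackWithin_apply, ContinuousLinearMap.inverse_eq h2 h1]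
  rfl

theorem SmoothVF.differentiableAt_chartField [I.Boundaryless] [CompleteSpace E] {V : VF I M}
    (hV : SmoothVF I V) (x₀ : M) :
    DifferentiableAt ℝ (chartField I x₀ V) (extChartAt I x₀ x₀) := by
  have h := ((hV.mdifferentiableAt x₀).mdifferentiableWithinAt
    (s := univ)).differentiableWithinAt_mpullbackWithin_vectorField
  rw [preimage_univ, univ_inter] at h
  have hr : range I ∈ 𝓝 (extChartAt I x₀ x₀) := by simp [I.range_eq_univ]
  exact (DifferentiableWithinAt.differentiableAt h hr).congr_of_eventuallyEq
    (chartField_eventuallyEq_mpullback x₀ V)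

theorem vfLie_eq_mlieBracket [I.Boundaryless] (V W : VF I M) :
    vfLie I V W = mlieBracket I V W := by
  ext x
  have hx := mem_extChartAt_target (I := I) x
  have h1 := mfderiv_extChartAt_comp_mfderivWithin_extChartAt_symm (I := I) hx
  have h2 := mfderivWithin_extChartAt_symm_comp_mfderiv_extChartAt (I := I) hx
  have h3 := (chartField_eventuallyEq_mpullback x V).lieBracket_vectorField_eq
    (chartField_eventuallyEq_mpullback x W) (𝕜 := ℝ)
  rw [← mlieBracketWithin_univ, mlieBracketWithin_apply, preimage_univ, univ_inter]
  have h4 := h3.trans (congrFun lieBracketWithin_univ.symm (extChartAt I x x))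
  rw [extChartAt_to_inv] at h1 h2
  have hr : range I = univ := I.range_eq_univ
  refine Eq.trans ?_ (congrArg (mfderiv I 𝓘(ℝ, E) (extChartAt I x) x).inverse
    (h4.trans (congrArg (fun s => lieBracketWithin ℝ _ _ s (extChartAt I x x)) hr.symm)))
  rw [ContinuousLinearMap.inverse_eq h1 h2, hr, mfderivWithin_univ]
  rfl

/-- The Lie bracket acts on functions as the commutator of derivations. -/
theorem vderiv_vfLie [I.Boundaryless] [CompleteSpace E] {V W : VF I M} {f : M → ℝ}
    (hV : SmoothVF I V) (hW : SmoothVF I W) (hf : SmoothFn I f) (x : M) :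
    vderiv I (vfLie I V W) f x =
      vderiv I V (vderiv I W f) x - vderiv I W (vderiv I V f) x := by
  have hxs := mem_extChartAt_source (I := I) x
  have hs : MDifferentiableAt 𝓘(ℝ, E) I (extChartAt I x).symm (extChartAt I x x) := by
    have := mdifferentiableWithinAt_extChartAt_symm (I := I) (mem_extChartAt_target x)
    rwa [I.range_eq_univ, mdifferentiableWithinAt_univ] at this
  have hfc : ContDiffAt ℝ ∞ (f ∘ (extChartAt I x).symm) (extChartAt I x x) := by
    have h := (contMDiffAt_iff_of_mem_source (I' := 𝓘(ℝ)) (x := x) (y := f x)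
      (mem_chart_source H x) (by simp)).1
      (hf x)
    simpa [I.range_eq_univ, contDiffWithinAt_univ, chartAt_self_eq] using h.2
  have hderiv : ∀ {U : VF I M},
      (fun e => fderiv ℝ (f ∘ (extChartAt I x).symm) e (chartField I x U e))
      =ᶠ[𝓝 (extChartAt I x x)] vderiv I U f ∘ (extChartAt I x).symm := by
    intro U
    filter_upwards [(isOpen_extChartAt_target (I := I) x).mem_nhds (mem_extChartAt_target x)]
      with e he
    have := fderiv_comp_extChartAt_symm_mfderiv (hf.mdifferentiableAt ((extChartAt I x).symm e))
      ((extChartAt I x).map_target he) (U ((extChartAt I x).symm e))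
    rw [(extChartAt I x).right_inv he] at this
    exact this
  have hpt : ∀ {U U' : VF I M}, SmoothVF I U →
      fderiv ℝ (vderiv I U f ∘ (extChartAt I x).symm) (extChartAt I x x)
        (chartField I x U' (extChartAt I x x)) = vderiv I U' (vderiv I U f) x := by
    intro U U' hU
    have := fderiv_comp_extChartAt_symm_mfderiv ((hf.vderiv hU).mdifferentiableAt x) hxs (U' x)
    unfold chartField
    rw [extChartAt_to_inv]
    exact this
  have hle : minSmoothness ℝ 2 ≤ ∞ := by
    simp only [minSmoothness_of_isRCLikeNormedField]
    exact ENat.LEInfty.out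
  have hmain := fderiv_apply_lieBracket (n := ∞) hfc hle (hW.differentiableAt_chartField x)
    (hV.differentiableAt_chartField x)
  rw [hderiv.fderiv_eq, hderiv.fderiv_eq, hpt hW, hpt hV] at hmain
  rw [← hmain, ← mfderiv_eq_fderiv, mfderiv_comp (I' := I) _ _ hs]
  · exact congrArg (fun y => (mfderiv I 𝓘(ℝ) f y : E →L[ℝ] ℝ)
      (mfderiv 𝓘(ℝ, E) I (extChartAt I x).symm (extChartAt I x x)
        (lieBracket ℝ (chartField I x V) (chartField I x W) (extChartAt I x x) : E)))
      (extChartAt_to_inv (I := I) x).symm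
  · rw [extChartAt_to_inv]; exact hf.mdifferentiableAt x

theorem SmoothVF.vfLie [I.Boundaryless] [CompleteSpace E] {V W : VF I M}
    (hV : SmoothVF I V) (hW : SmoothVF I W) : SmoothVF I (vfLie I V W) := by
  have hinst : IsManifold I (((⊤ : ℕ∞) : WithTop ℕ∞) + 1) M := by simpa
  have hinst' : IsManifold I (minSmoothness ℝ 2) M := by
    simp only [minSmoothness_of_isRCLikeNormedField]
    infer_instance
  rw [vfLie_eq_mlieBracket]
  exact ContDiff.mlieBracket_vectorField (m := ⊤) (n := ⊤) hV hW (by simp)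

theorem vfLie_swap [I.Boundaryless] (V W : VF I M) (x : M) :
    vfLie I V W x = - vfLie I W V x := by
  simp only [vfLie_eq_mlieBracket]
  exact mlieBracket_swap_apply

/-- The Jacobi identity. -/
theorem vfLie_jacobi [I.Boundaryless] [CompleteSpace E] {U V W : VF I M}
    (hU : SmoothVF I U) (hV : SmoothVF I V) (hW : SmoothVF I W) (x : M) :
    vfLie I U (vfLie I V W) x = vfLie I (vfLie I U V) W x + vfLie I V (vfLie I U W) x := by
  have h2 : minSmoothness ℝ 2 ≤ ∞ := by
    simp only [minSmoothness_of_isRCLikeNormedField]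
    exact ENat.LEInfty.out
  have h3 : minSmoothness ℝ 3 ≤ ∞ := by
    simp only [minSmoothness_of_isRCLikeNormedField]
    exact ENat.LEInfty.out
  have hinst : IsManifold I (minSmoothness ℝ 3) M := IsManifold.of_le h3
  simp only [vfLie_eq_mlieBracket]
  exact leibniz_identity_mlieBracket_apply ((hU x).of_le h2) ((hV x).of_le h2) ((hW x).of_le h2)

theorem vfLie_add_left [I.Boundaryless] [CompleteSpace E] {V V' : VF I M} (W : VF I M) {x : M}
    (hV : MDifferentiableAt I I.tangent (fun y => (⟨y, V y⟩ : TangentBundle I M)) x)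
    (hV' : MDifferentiableAt I I.tangent (fun y => (⟨y, V' y⟩ : TangentBundle I M)) x) :
    vfLie I (V + V') W x = vfLie I V W x + vfLie I V' W x := by
  simp only [vfLie_eq_mlieBracket]
  exact mlieBracket_add_left hV hV'

theorem vfLie_smul_left [I.Boundaryless] [CompleteSpace E] {f : M → ℝ} {V : VF I M} (W : VF I M)
    {x : M} (hf : MDifferentiableAt I 𝓘(ℝ) f x)
    (hV : MDifferentiableAt I I.tangent (fun y => (⟨y, V y⟩ : TangentBundle I M)) x) :
    vfLie I (f • V) W x = - vderiv I W f x • V x + f x • vfLie I V W x := by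
  simp only [vfLie_eq_mlieBracket]
  exact mlieBracket_smul_left hf hV

theorem vfLie_congr_left [I.Boundaryless] {V V' : VF I M} (W : VF I M) {x : M}
    (h : V =ᶠ[𝓝 x] V') : vfLie I V W x = vfLie I V' W x := by
  simp only [vfLie_eq_mlieBracket]
  exact h.mlieBracket_vectorField_eq EventuallyEq.rfl

end LieBracket

section ExteriorDerivative

open Filter
open scoped Topology

theorem SmoothFn.add {f h : M → ℝ} (hf : SmoothFn I f) (hh : SmoothFn I h) :
    SmoothFn I (fun x => f x + h x) := ContMDiff.add hf hh

theorem SmoothFn.sub {f h : M → ℝ} (hf : SmoothFn I f) (hh : SmoothFn I h) :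
    SmoothFn I (fun x => f x - h x) := ContMDiff.sub hf hh

theorem SmoothFn.mul {f h : M → ℝ} (hf : SmoothFn I f) (hh : SmoothFn I h) :
    SmoothFn I (fun x => f x * h x) := ContMDiff.mul hf hh

theorem vderiv_congr {V V' : VF I M} {f f' : M → ℝ} {x : M} (hV : V x = V' x)
    (hf : f =ᶠ[𝓝 x] f') : vderiv I V f x = vderiv I V' f' x := by
  have h := hf.mfderiv_eq (I := I) (I' := 𝓘(ℝ))
  rw [vderiv, vderiv, hV]
  exact congrArg (fun L : E →L[ℝ] ℝ => L (V' x)) h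

theorem vderiv_const (V : VF I M) (c : ℝ) (x : M) : vderiv I V (fun _ => c) x = 0 := by
  rw [vderiv, mfderiv_const]
  rfl

theorem vderiv_add {f h : M → ℝ} (V : VF I M) {x : M} (hf : MDifferentiableAt I 𝓘(ℝ) f x)
    (hh : MDifferentiableAt I 𝓘(ℝ) h x) :
    vderiv I V (fun y => f y + h y) x = vderiv I V f x + vderiv I V h x :=
  congrArg (fun L : E →L[ℝ] ℝ => L (V x)) (mfderiv_add hf hh)

theorem vderiv_sub {f h : M → ℝ} (V : VF I M) {x : M} (hf : MDifferentiableAt I 𝓘(ℝ) f x)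
    (hh : MDifferentiableAt I 𝓘(ℝ) h x) :
    vderiv I V (fun y => f y - h y) x = vderiv I V f x - vderiv I V h x :=
  congrArg (fun L : E →L[ℝ] ℝ => L (V x)) (mfderiv_sub hf hh)

theorem vderiv_mul {f h : M → ℝ} (V : VF I M) {x : M} (hf : MDifferentiableAt I 𝓘(ℝ) f x)
    (hh : MDifferentiableAt I 𝓘(ℝ) h x) :
    vderiv I V (fun y => f y * h y) x = f x * vderiv I V h x + h x * vderiv I V f x :=
  congrArg (fun L : E →L[ℝ] ℝ => L (V x)) (hf.hasMFDerivAt.mul hh.hasMFDerivAt).mfderiv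

theorem vderiv_add_left (V W : VF I M) (f : M → ℝ) (x : M) :
    vderiv I (V + W) f x = vderiv I V f x + vderiv I W f x :=
  (mfderiv I 𝓘(ℝ) f x).map_add (V x) (W x)

theorem vderiv_smul_left (a : M → ℝ) (V : VF I M) (f : M → ℝ) (x : M) :
    vderiv I (a • V) f x = a x * vderiv I V f x :=
  (mfderiv I 𝓘(ℝ) f x).map_smul (a x) (V x)

theorem OneForm.d_apply (ω : OneForm I M) (V W : VF I M) (x : M) :
    ω.d V W x = vderiv I V (fun y => ω.val y (W y)) x - vderiv I W (fun y => ω.val y (V y)) x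
      - ω.val x (vfLie I V W x) := rfl

theorem OneForm.d_swap [I.Boundaryless] (ω : OneForm I M) (V W : VF I M) (x : M) :
    ω.d V W x = - ω.d W V x := by
  rw [ω.d_apply, ω.d_apply, vfLie_swap, map_neg]
  ring

theorem OneForm.smooth_d [I.Boundaryless] [CompleteSpace E] (ω : OneForm I M) {V W : VF I M}
    (hV : SmoothVF I V) (hW : SmoothVF I W) : SmoothFn I (ω.d V W) :=
  (((ω.smooth' W hW).vderiv hV).sub ((ω.smooth' V hV).vderiv hW)).sub
    (ω.smooth' _ (hV.vfLie hW))

theorem OneForm.d_congr_left [I.Boundaryless] (ω : OneForm I M) {V V' : VF I M} (W : VF I M)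
    {x : M} (h : V =ᶠ[𝓝 x] V') : ω.d V W x = ω.d V' W x := by
  have h1 : (fun y => ω.val y (V y)) =ᶠ[𝓝 x] fun y => ω.val y (V' y) := by
    filter_upwards [h] with y hy
    rw [hy]
  rw [ω.d_apply, ω.d_apply, vderiv_congr h.self_of_nhds EventuallyEq.rfl,
    vderiv_congr rfl h1, vfLie_congr_left W h]

theorem OneForm.d_sum_smul_left [I.Boundaryless] [CompleteSpace E] (ω : OneForm I M)
    {ι : Type*} [DecidableEq ι] (s : Finset ι) {f : ι → M → ℝ} {e : ι → VF I M} {x : M}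
    (hf : ∀ i, MDifferentiableAt I 𝓘(ℝ) (f i) x) (he : ∀ i, SmoothVF I (e i)) (W : VF I M) :
    MDifferentiableAt I I.tangent
        (fun y => (⟨y, (∑ i ∈ s, f i • e i) y⟩ : TangentBundle I M)) x ∧
      MDifferentiableAt I 𝓘(ℝ) (fun y => ω.val y ((∑ i ∈ s, f i • e i) y)) x ∧
      ω.d (∑ i ∈ s, f i • e i) W x = ∑ i ∈ s, f i x * ω.d (e i) W x := by
  induction s using Finset.induction_on with
  | empty =>
    have h0 : (∑ i ∈ (∅ : Finset ι), f i • e i) = (0 : VF I M) := Finset.sum_empty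
    have hz : (fun y => ω.val y ((0 : VF I M) y)) = fun _ => 0 := by
      funext y
      exact map_zero _
    rw [h0]
    refine ⟨?_, ?_, ?_⟩
    · exact (Bundle.contMDiff_zeroSection ℝ (TangentSpace I : M → Type _)).mdifferentiableAt
        one_ne_zero
    · rw [hz]
      exact mdifferentiableAt_const
    · have h1 : vderiv I (0 : VF I M) (fun y => ω.val y (W y)) x = 0 := map_zero _
      have h2 : vfLie I 0 W x = 0 := by
        rw [vfLie_eq_mlieBracket, VectorField.mlieBracket_zero_left]
        rfl
      rw [ω.d_apply, hz, h1, h2, vderiv_const, map_zero]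
      simp
  | insert i s hi ih =>
    obtain ⟨ih1, ih2, ih3⟩ := ih
    have hV := (he i).mdifferentiableAt x
    have hs := MDifferentiableAt.smul_section (hf i) hV
    have hω := (ω.smooth' _ (he i)).mdifferentiableAt x
    have hωs : MDifferentiableAt I 𝓘(ℝ) (fun y => f i y * ω.val y (e i y)) x :=
      (hf i).mul hω
    have e1 : (fun y => ω.val y ((f i • e i) y)) = fun y => f i y * ω.val y (e i y) := by
      funext y
      exact map_smul _ _ _
    have e2 : (fun y => ω.val y ((f i • e i + ∑ i ∈ s, f i • e i) y)) =
        fun y => f i y * ω.val y (e i y) + ω.val y ((∑ i ∈ s, f i • e i) y) := by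
      funext y
      rw [Pi.add_apply, map_add]
      exact congrArg (· + _) (congrFun e1 y)
    rw [Finset.sum_insert hi, Finset.sum_insert hi]
    refine ⟨mdifferentiableAt_add_section hs ih1, ?_, ?_⟩
    · rw [e2]
      exact hωs.add ih2
    · rw [← ih3, ω.d_apply, e2, vderiv_add _ hωs ih2, vderiv_mul _ (hf i) hω,
        vderiv_add_left, vderiv_smul_left, vfLie_add_left W hs ih1, map_add,
        vfLie_smul_left W (hf i) hV, map_add, map_smul, map_smul, ω.d_apply, ω.d_apply]
      simp only [smul_eq_mul]
      ring

/-- A finite family of smooth vector fields near `x`, generating the tangent spaces, together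
with the (differentiable) coefficients of vectors with respect to it. -/
structure LocalGenerators (I : ModelWithCorners ℝ E H) {M : Type*} [TopologicalSpace M]
    [ChartedSpace H M] [IsManifold I (⊤ : ℕ∞) M] (x : M) {ι : Type*} [Fintype ι]
    (e : ι → VF I M) (c : ι → ∀ y : M, TangentSpace I y →ₗ[ℝ] ℝ) : Prop where
  smooth : ∀ i, SmoothVF I (e i)
  mdifferentiableAt : ∀ i V, SmoothVF I V →
    MDifferentiableAt I 𝓘(ℝ) (fun y => c i y (V y)) x
  eq_sum : ∀ᶠ y in 𝓝 x, ∀ v, v = ∑ i, c i y v • e i y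

theorem LocalGenerators.d_eq [I.Boundaryless] [CompleteSpace E] {x : M} {ι : Type*} [Fintype ι]
    {e : ι → VF I M} {c : ι → ∀ y : M, TangentSpace I y →ₗ[ℝ] ℝ}
    (h : LocalGenerators I x e c) (ω : OneForm I M) {V : VF I M} (hV : SmoothVF I V)
    (W : VF I M) : ω.d V W x = ∑ i, c i x (V x) * ω.d (e i) W x := by
  classical
  rw [← (ω.d_sum_smul_left Finset.univ (f := fun i y => c i y (V y))
    (fun i => h.mdifferentiableAt i V hV) h.smooth W).2.2]
  refine ω.d_congr_left W ?_
  filter_upwards [h.eq_sum] with y hy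
  rw [Finset.sum_apply]
  exact hy (V y)

/-- The exterior derivative of a `1`-form is tensorial. -/
theorem LocalGenerators.exists_bilin [I.Boundaryless] [CompleteSpace E] {x : M} {ι : Type*}
    [Fintype ι] {e : ι → VF I M} {c : ι → ∀ y : M, TangentSpace I y →ₗ[ℝ] ℝ}
    (h : LocalGenerators I x e c) (ω : OneForm I M) :
    ∃ B : TangentSpace I x →ₗ[ℝ] TangentSpace I x →ₗ[ℝ] ℝ, (∀ v, B v v = 0) ∧
      ∀ V W, SmoothVF I V → SmoothVF I W → ω.d V W x = B (V x) (W x) := by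
  refine ⟨∑ i, ∑ j, ω.d (e i) (e j) x • (c i x).smulRight (c j x), fun v => ?_,
    fun V W hV hW => ?_⟩
  · have hsum : (∑ i, ∑ j, ω.d (e i) (e j) x • (c i x).smulRight (c j x)) v v =
        ∑ i, ∑ j, ω.d (e i) (e j) x * (c i x v * c j x v) := by
      simp [LinearMap.sum_apply]
    rw [hsum]
    have hneg : ∑ i, ∑ j, ω.d (e i) (e j) x * (c i x v * c j x v) =
        - ∑ i, ∑ j, ω.d (e i) (e j) x * (c i x v * c j x v) := by
      conv_lhs => rw [Finset.sum_comm]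
      simp only [← Finset.sum_neg_distrib]
      refine Finset.sum_congr rfl fun i _ => Finset.sum_congr rfl fun j _ => ?_
      rw [ω.d_swap (e j) (e i)]
      ring
    linarith
  · have hexp : ω.d V W x = ∑ i, ∑ j, ω.d (e i) (e j) x * (c i x (V x) * c j x (W x)) := by
      rw [h.d_eq ω hV W]
      refine Finset.sum_congr rfl fun i _ => ?_
      rw [ω.d_swap, h.d_eq ω hW (e i), ← Finset.sum_neg_distrib, Finset.mul_sum]
      refine Finset.sum_congr rfl fun j _ => ?_
      rw [ω.d_swap (e i) (e j)]
      ring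
    rw [hexp]
    simp [LinearMap.sum_apply]

/-- The exterior derivative of a `1`-form is closed. -/
theorem OneForm.d_closed [I.Boundaryless] [CompleteSpace E] (ω : OneForm I M) {U V W : VF I M}
    (hU : SmoothVF I U) (hV : SmoothVF I V) (hW : SmoothVF I W) (x : M) :
    vderiv I U (ω.d V W) x - vderiv I V (ω.d U W) x + vderiv I W (ω.d U V) x
      - ω.d (vfLie I U V) W x + ω.d (vfLie I U W) V x - ω.d (vfLie I V W) U x = 0 := by
  have key : ∀ {A B C : VF I M}, SmoothVF I A → SmoothVF I B → SmoothVF I C →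
      vderiv I A (ω.d B C) x = vderiv I A (vderiv I B fun y => ω.val y (C y)) x
        - vderiv I A (vderiv I C fun y => ω.val y (B y)) x
        - vderiv I A (fun y => ω.val y (vfLie I B C y)) x := by
    intro A B C hA hB hC
    have h1 := (ω.smooth' C hC).vderiv hB
    have h2 := (ω.smooth' B hB).vderiv hC
    have h3 := ω.smooth' _ (hB.vfLie hC)
    rw [← vderiv_sub A (h1.mdifferentiableAt x) (h2.mdifferentiableAt x),
      ← vderiv_sub A ((h1.sub h2).mdifferentiableAt x) (h3.mdifferentiableAt x)]
    rfl
  have hj := congrArg (ω.val x) (vfLie_jacobi hU hV hW x)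
  rw [map_add, vfLie_swap U (vfLie I V W), vfLie_swap V (vfLie I U W), map_neg, map_neg] at hj
  rw [key hU hV hW, key hV hU hW, key hW hU hV, ω.d_apply, ω.d_apply, ω.d_apply,
    vderiv_vfLie hU hV (ω.smooth' W hW), vderiv_vfLie hU hW (ω.smooth' V hV),
    vderiv_vfLie hV hW (ω.smooth' U hU)]
  linarith

end ExteriorDerivative

section LinearAlgebra

variable {V : Type*} [AddCommGroup V] [Module ℝ V]

/-- Expansion of a vector of a plane in a basis, in terms of a symmetric bilinear form that is
nondegenerate on it. -/
theorem gram_smul_eq {b : V →ₗ[ℝ] V →ₗ[ℝ] ℝ} (hb : ∀ u v, b u v = b v u) {S : Submodule ℝ V}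
    (hS : finrank ℝ S = 2) {w u : V} (hw : w ∈ S) (hu : u ∈ S)
    (hG : b w w * b u u - b w u ^ 2 ≠ 0) {d : V} (hd : d ∈ S) :
    (b w w * b u u - b w u ^ 2) • d =
      (b u u * b w d - b w u * b u d) • w + (b w w * b u d - b w u * b w d) • u := by
  have hind : LinearIndependent ℝ ![(⟨w, hw⟩ : S), ⟨u, hu⟩] := by
    refine LinearIndependent.pair_iff.mpr fun s t hst => ?_
    have hst' : s • w + t • u = 0 := congrArg Subtype.val hst
    have h1 : s * b w w + t * b w u = 0 := by simpa using congrArg (b w) hst'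
    have h2 : s * b w u + t * b u u = 0 := by simpa [hb u w] using congrArg (b u) hst'
    constructor
    · refine (mul_eq_zero.mp ?_).resolve_right hG
      linear_combination b u u * h1 - b w u * h2
    · refine (mul_eq_zero.mp ?_).resolve_right hG
      linear_combination b w w * h2 - b w u * h1
  have : FiniteDimensional ℝ S := FiniteDimensional.of_finrank_pos (by omega)
  have hspan := hind.span_eq_top_of_card_eq_finrank' (by simp [hS])
  have hd' : (⟨d, hd⟩ : S) ∈ Submodule.span ℝ (Set.range ![(⟨w, hw⟩ : S), ⟨u, hu⟩]) := by
    rw [hspan]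
    trivial
  rw [Matrix.range_cons, Matrix.range_cons, Matrix.range_empty, union_empty,
    Set.singleton_union] at hd'
  obtain ⟨p, q, hpq⟩ := Submodule.mem_span_pair.mp hd'
  have hpq' : p • w + q • u = d := congrArg Subtype.val hpq
  subst hpq'
  simp only [map_add, map_smul, smul_eq_mul, hb u w]
  module

theorem gram_pos {b : V →ₗ[ℝ] V →ₗ[ℝ] ℝ} (hb : ∀ u v, b u v = b v u)
    (hpos : ∀ v, v ≠ 0 → 0 < b v v) {w u : V} (hw : w ≠ 0) (hu : u ∉ Submodule.span ℝ {w}) :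
    0 < b w w * b u u - b w u ^ 2 := by
  have hww := hpos w hw
  have hv : b w w • u - b w u • w ≠ 0 := by
    intro h0
    refine hu (Submodule.mem_span_singleton.mpr ⟨b w u / b w w, ?_⟩)
    rw [sub_eq_zero] at h0
    rw [div_eq_inv_mul, mul_smul, ← h0, smul_smul, inv_mul_cancel₀ hww.ne', one_smul]
  have h := hpos _ hv
  simp only [map_sub, map_smul, LinearMap.sub_apply, LinearMap.smul_apply, smul_eq_mul,
    hb u w] at h
  refine pos_of_mul_pos_right (a := b w w) ?_ hww.le
  nlinarith

theorem neg_eq_of_alternating {B : V →ₗ[ℝ] V →ₗ[ℝ] ℝ} (hB : ∀ v, B v v = 0) (u v : V) :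
    B u v = - B v u := by
  have h := hB (u + v)
  simp only [map_add, LinearMap.add_apply, hB] at h
  linarith

/-- An alternating form on a space generated by four vectors, one of which lies in its kernel,
has square zero. -/
theorem alternating_sq_eq_zero {B : V →ₗ[ℝ] V →ₗ[ℝ] ℝ} (hB : ∀ v, B v v = 0) {w u t r : V}
    (hr : ∀ v, B r v = 0)
    (hgen : ∀ v, ∃ p q b a : ℝ, v = p • w + q • u + b • t + a • r) (v₀ v₁ v₂ v₃ : V) :
    B v₀ v₁ * B v₂ v₃ - B v₀ v₂ * B v₁ v₃ + B v₀ v₃ * B v₁ v₂ = 0 := by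
  obtain ⟨p₀, q₀, b₀, a₀, rfl⟩ := hgen v₀
  obtain ⟨p₁, q₁, b₁, a₁, rfl⟩ := hgen v₁
  obtain ⟨p₂, q₂, b₂, a₂, rfl⟩ := hgen v₂
  obtain ⟨p₃, q₃, b₃, a₃, rfl⟩ := hgen v₃
  have hr' : ∀ v, B v r = 0 := fun v => by rw [neg_eq_of_alternating hB, hr, neg_zero]
  simp only [map_add, map_smul, LinearMap.add_apply, LinearMap.smul_apply, smul_eq_mul, hB, hr,
    hr', neg_eq_of_alternating hB u w, neg_eq_of_alternating hB t w,
    neg_eq_of_alternating hB t u]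
  ring

end LinearAlgebra

section Splitting

open Filter
open scoped Topology

/-- The Gram determinant of two vector fields. -/
def RMetric.gram (g : RMetric I M) (W X : VF I M) (x : M) : ℝ :=
  g.val x (W x) (W x) * g.val x (X x) (X x) - g.val x (W x) (X x) ^ 2

theorem RMetric.smooth_gram (g : RMetric I M) {W X : VF I M} (hW : SmoothVF I W)
    (hX : SmoothVF I X) : SmoothFn I (g.gram W X) := by
  have h := ((g.smooth' W W hW hW).mul (g.smooth' X X hX hX)).sub
    ((g.smooth' W X hW hX).mul (g.smooth' W X hW hX))
  simp only [← sq] at h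
  exact h

/-- The splitting of the tangent bundle into a bracket-generating plane field `D` and the
`g`-orthogonal Reeb distribution spanned by `T` and `R`. -/
structure ReebSplitting (D : TangentDist I M) (α β : OneForm I M) (T R : VF I M)
    (g : RMetric I M) : Prop extends IsReebPair I α β T R where
  mem_iff : ∀ x v, v ∈ D x ↔ α.val x v = 0 ∧ β.val x v = 0
  finrank_eq : ∀ x, finrank ℝ (D x) = 2
  orthT : ∀ x, ∀ u ∈ D x, g.val x (T x) u = 0
  orthR : ∀ x, ∀ u ∈ D x, g.val x (R x) u = 0
  derived_le : ∀ x, derivedDist I D x ≤ LinearMap.ker (α.val x)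
  not_derived_le : ∀ x, ¬ derivedDist I D x ≤ D x
  span_smooth : ∀ x, Submodule.span ℝ {v | ∃ V : VF I M, SmoothVF I V ∧ V x = v} = ⊤

variable {D : TangentDist I M} {α β : OneForm I M} {T R : VF I M} {g : RMetric I M}

theorem IsReebPair.d_T_eq_zero (h : IsReebPair I α β T R) {W : VF I M} (hW : SmoothVF I W)
    (x : M) (hα : α.val x (W x) = 0) : β.d T W x = 0 := by
  have h1 := h.insT W R hW h.smoothR x
  rw [wedge1_2, h.alphaT, h.alphaR, hα] at h1
  linarith

theorem IsReebPair.d_R (h : IsReebPair I α β T R) {W : VF I M} (hW : SmoothVF I W) (x : M) :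
    β.d R W x = β.val x (W x) * β.d R T x := by
  have h1 := h.insR W T hW h.smoothT x
  rw [wedge1_2, h.betaT, h.betaR] at h1
  linarith

theorem IsReebPair.proj_mem (h : IsReebPair I α β T R) {x : M}
    {S : Submodule ℝ (TangentSpace I x)} (hS : ∀ v, v ∈ S ↔ α.val x v = 0 ∧ β.val x v = 0)
    (v : TangentSpace I x) :
    v - β.val x v • T x - α.val x v • R x ∈ S := by
  rw [hS]
  simp [h.alphaT, h.betaT, h.alphaR, h.betaR]

/-- The product of a smooth function and a `1`-form. -/
def OneForm.scale (θ : OneForm I M) {μ : M → ℝ} (hμ : SmoothFn I μ) : OneForm I M where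
  val x := μ x • θ.val x
  smooth' V hV := hμ.mul (θ.smooth' V hV)

theorem OneForm.d_scale (θ : OneForm I M) {μ : M → ℝ} (hμ : SmoothFn I μ) {V Y : VF I M}
    (hV : SmoothVF I V) (hY : SmoothVF I Y) (x : M) :
    (θ.scale hμ).d V Y x = vderiv I V μ x * θ.val x (Y x) - vderiv I Y μ x * θ.val x (V x)
      + μ x * θ.d V Y x := by
  have e : ∀ U : VF I M, (fun y => (θ.scale hμ).val y (U y)) = fun y => μ y * θ.val y (U y) :=
    fun _ => rfl
  have e' : (θ.scale hμ).val x (vfLie I V Y x) = μ x * θ.val x (vfLie I V Y x) := rfl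
  rw [OneForm.d_apply, e, e, e', θ.d_apply,
    vderiv_mul V (hμ.mdifferentiableAt x) ((θ.smooth' Y hY).mdifferentiableAt x),
    vderiv_mul Y (hμ.mdifferentiableAt x) ((θ.smooth' V hV).mdifferentiableAt x)]
  ring

namespace ReebSplitting

theorem isSection_proj (h : ReebSplitting D α β T R g) {V : VF I M} (hV : SmoothVF I V) :
    IsSection I D
      (V - (fun y => β.val y (V y)) • T - (fun y => α.val y (V y)) • R) :=
  ⟨(hV.sub (h.smoothT.smul (β.smooth' V hV))).sub (h.smoothR.smul (α.smooth' V hV)),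
    fun x => h.toIsReebPair.proj_mem (h.mem_iff x) (V x)⟩

/-- Every vector of `D` extends to a combination of global sections. -/
theorem le_span_sections (h : ReebSplitting D α β T R g) (x : M) :
    D x ≤ Submodule.span ℝ {v | ∃ V, IsSection I D V ∧ V x = v} := by
  let P : TangentSpace I x →ₗ[ℝ] TangentSpace I x :=
    LinearMap.id - (β.val x).smulRight (T x) - (α.val x).smulRight (R x)
  have hP : ∀ v, P v ∈ Submodule.span ℝ {v | ∃ V, IsSection I D V ∧ V x = v} := by
    intro v
    have hv : v ∈ Submodule.span ℝ {v | ∃ V : VF I M, SmoothVF I V ∧ V x = v} := by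
      rw [h.span_smooth]
      trivial
    induction hv using Submodule.span_induction with
    | mem v hv =>
      obtain ⟨V, hV, rfl⟩ := hv
      exact Submodule.subset_span ⟨_, h.isSection_proj hV, rfl⟩
    | zero => simp
    | add u v _ _ hu hv =>
      rw [map_add]
      exact add_mem hu hv
    | smul a v _ hv =>
      rw [map_smul]
      exact Submodule.smul_mem _ _ hv
  intro v hv
  have h0 := (h.mem_iff x v).mp hv
  have := hP v
  simpa [P, h0.1, h0.2] using this

/-- Near each point, `D` is spanned by two global sections. -/
theorem exists_gram_pos (h : ReebSplitting D α β T R g) (x : M) :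
    ∃ W X, IsSection I D W ∧ IsSection I D X ∧ 0 < g.gram W X x := by
  have key : ∀ S : Submodule ℝ (TangentSpace I x), ¬ D x ≤ S →
      ∃ V, IsSection I D V ∧ V x ∉ S := by
    intro S hS
    by_contra! hcon
    refine hS ((h.le_span_sections x).trans (Submodule.span_le.mpr ?_))
    rintro _ ⟨V, hV, rfl⟩
    exact hcon V hV
  have hfr := h.finrank_eq x
  obtain ⟨W, hW, hWx⟩ := key ⊥ fun hle => by
    rw [le_bot_iff.mp hle, finrank_bot] at hfr
    omega
  obtain ⟨X, hX, hXx⟩ := key (Submodule.span ℝ {W x}) fun hle => by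
    have h1 := (Submodule.finrank_mono hle).trans (finrank_span_singleton (K := ℝ) hWx).le
    omega
  exact ⟨W, X, hW, hX, gram_pos (g.symm x) (g.posdef x) hWx hXx⟩

theorem exists_eq_of_mem (h : ReebSplitting D α β T R g) {W X : VF I M} (hW : IsSection I D W)
    (hX : IsSection I D X) {x : M} (hG : g.gram W X x ≠ 0) {v : TangentSpace I x}
    (hv : v ∈ D x) : ∃ p q : ℝ, v = p • W x + q • X x := by
  have h1 := gram_smul_eq (g.symm x) (h.finrank_eq x) (hW.2 x) (hX.2 x) hG hv
  have h2 : v = (g.gram W X x)⁻¹ • (_ + _) :=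
    (inv_smul_smul₀ hG v).symm.trans (congrArg (fun z => (g.gram W X x)⁻¹ • z) h1)
  rw [smul_add, smul_smul, smul_smul] at h2
  exact ⟨_, _, h2⟩

theorem exists_eq (h : ReebSplitting D α β T R g) {W X : VF I M} (hW : IsSection I D W)
    (hX : IsSection I D X) {x : M} (hG : g.gram W X x ≠ 0) {α' β' : OneForm I M}
    {T' R' : VF I M} (h' : IsReebPair I α' β' T' R')
    (hD : ∀ v, v ∈ D x ↔ α'.val x v = 0 ∧ β'.val x v = 0) (v : TangentSpace I x) :
    ∃ p q : ℝ, v = p • W x + q • X x + β'.val x v • T' x + α'.val x v • R' x := by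
  obtain ⟨p, q, hpq⟩ := h.exists_eq_of_mem hW hX hG (h'.proj_mem hD v)
  refine ⟨p, q, ?_⟩
  rw [← hpq]
  abel

theorem exists_localGenerators (h : ReebSplitting D α β T R g) {W X : VF I M}
    (hW : IsSection I D W) (hX : IsSection I D X) {x : M} (hG : g.gram W X x ≠ 0) :
    ∃ c, LocalGenerators I x ![W, X, T, R] c := by
  have hsG := g.smooth_gram hW.1 hX.1
  have hWW := g.smooth' W W hW.1 hW.1
  have hWX := g.smooth' W X hW.1 hX.1
  have hXX := g.smooth' X X hX.1 hX.1
  have hcoef : ∀ {a b : M → ℝ} {A B V : VF I M}, SmoothFn I a → SmoothFn I b → SmoothVF I A →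
      SmoothVF I B → SmoothVF I V → MDifferentiableAt I 𝓘(ℝ) (fun y =>
        ((g.gram W X y)⁻¹ • (a y • g.val y (A y) - b y • g.val y (B y))) (V y)) x := by
    intro a b A B V ha hb hA hB hV
    have h1 : ContMDiffAt I 𝓘(ℝ) (⊤ : ℕ∞) (fun y => (g.gram W X y)⁻¹) x :=
      (contDiffAt_inv ℝ hG).contMDiffAt.comp x (hsG x)
    have h2 := (ha.mul (g.smooth' A V hA hV)).sub (hb.mul (g.smooth' B V hB hV))
    exact (h1.mul (h2 x)).mdifferentiableAt (by simp)
  refine ⟨![fun y => (g.gram W X y)⁻¹ •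
      (g.val y (X y) (X y) • g.val y (W y) - g.val y (W y) (X y) • g.val y (X y)),
    fun y => (g.gram W X y)⁻¹ •
      (g.val y (W y) (W y) • g.val y (X y) - g.val y (W y) (X y) • g.val y (W y)),
    β.val, α.val], ?_, ?_, ?_⟩
  · simp only [Fin.forall_fin_succ]
    exact ⟨hW.1, hX.1, h.smoothT, h.smoothR, fun i => i.elim0⟩
  · simp only [Fin.forall_fin_succ]
    exact ⟨fun V hV => hcoef hXX hWX hW.1 hX.1 hV, fun V hV => hcoef hWW hWX hX.1 hW.1 hV,
      fun V hV => (β.smooth' V hV).mdifferentiableAt x,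
      fun V hV => (α.smooth' V hV).mdifferentiableAt x, fun i => i.elim0⟩
  · filter_upwards [(ContMDiff.continuous hsG).continuousAt.eventually_ne hG] with y hy v
    have h1 := gram_smul_eq (g.symm y) (h.finrank_eq y) (hW.2 y) (hX.2 y) hy
      (h.toIsReebPair.proj_mem (h.mem_iff y) v)
    have h2 : ∀ u ∈ D y, g.val y u (v - β.val y v • T y - α.val y v • R y) = g.val y u v := by
      intro u hu
      simp [g.symm y u (T y), g.symm y u (R y), h.orthT y u hu, h.orthR y u hu]
    rw [h2 _ (hW.2 y), h2 _ (hX.2 y)] at h1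
    have h3 := congrArg (fun z => (g.gram W X y)⁻¹ • z) h1
    have h4 : (g.gram W X y)⁻¹ • (g.val y (W y) (W y) * g.val y (X y) (X y)
        - g.val y (W y) (X y) ^ 2) • (v - β.val y v • T y - α.val y v • R y) =
        v - β.val y v • T y - α.val y v • R y := inv_smul_smul₀ hy _
    rw [h4, sub_sub, sub_eq_iff_eq_add, smul_add, smul_smul, smul_smul, ← add_assoc] at h3
    rw [Fin.sum_univ_four]
    exact h3

/-- The exterior derivative of any `1`-form is tensorial. -/
theorem exists_bilin [I.Boundaryless] [CompleteSpace E] (h : ReebSplitting D α β T R g)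
    (θ : OneForm I M) (x : M) :
    ∃ B : TangentSpace I x →ₗ[ℝ] TangentSpace I x →ₗ[ℝ] ℝ, (∀ v, B v v = 0) ∧
      ∀ V W, SmoothVF I V → SmoothVF I W → θ.d V W x = B (V x) (W x) := by
  obtain ⟨W, X, hW, hX, hG⟩ := h.exists_gram_pos x
  obtain ⟨c, hc⟩ := h.exists_localGenerators hW hX hG.ne'
  exact hc.exists_bilin θ

theorem d_eq_neg_val_vfLie (h : ReebSplitting D α β T R g) {W X : VF I M}
    (hW : IsSection I D W) (hX : IsSection I D X) (x : M) :
    β.d W X x = - β.val x (vfLie I W X x) := by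
  have h1 : (fun y => β.val y (W y)) = fun _ => 0 :=
    funext fun y => ((h.mem_iff y _).mp (hW.2 y)).2
  have h2 : (fun y => β.val y (X y)) = fun _ => 0 :=
    funext fun y => ((h.mem_iff y _).mp (hX.2 y)).2
  rw [β.d_apply, h1, h2, vderiv_const, vderiv_const]
  ring

theorem d_R_section (h : ReebSplitting D α β T R g) {W : VF I M} (hW : IsSection I D W) (x : M) :
    β.d R W x = 0 := by
  rw [h.d_R hW.1, ((h.mem_iff x _).mp (hW.2 x)).2, zero_mul]

theorem exists_transition [I.Boundaryless] [CompleteSpace E] (h : ReebSplitting D α β T R g)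
    {W X : VF I M} (hW : IsSection I D W) (hX : IsSection I D X) {x : M}
    (hG : g.gram W X x ≠ 0) {W' X' : VF I M} (hW' : IsSection I D W') (hX' : IsSection I D X') :
    ∃ δ : ℝ, g.gram W' X' x = δ ^ 2 * g.gram W X x ∧ β.d W' X' x = δ * β.d W X x := by
  obtain ⟨B, hB, hd⟩ := h.exists_bilin β x
  obtain ⟨p, q, hpq⟩ := h.exists_eq_of_mem hW hX hG (hW'.2 x)
  obtain ⟨r, s, hrs⟩ := h.exists_eq_of_mem hW hX hG (hX'.2 x)
  refine ⟨p * s - q * r, ?_, ?_⟩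
  · simp only [RMetric.gram, hpq, hrs, map_add, map_smul, LinearMap.add_apply,
      LinearMap.smul_apply, smul_eq_mul, g.symm x (X x) (W x)]
    ring
  · simp only [hd _ _ hW'.1 hX'.1, hd _ _ hW.1 hX.1, hpq, hrs, map_add, map_smul,
      LinearMap.add_apply, LinearMap.smul_apply, smul_eq_mul, hB,
      neg_eq_of_alternating hB (X x) (W x)]
    ring

theorem d_ne_zero [I.Boundaryless] [CompleteSpace E] (h : ReebSplitting D α β T R g)
    {W X : VF I M} (hW : IsSection I D W) (hX : IsSection I D X) {x : M}
    (hG : g.gram W X x ≠ 0) : β.d W X x ≠ 0 := by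
  intro h0
  refine h.not_derived_le x (Submodule.span_le.mpr ?_)
  rintro _ (⟨V, hV, rfl⟩ | ⟨V, Y, hV, hY, rfl⟩)
  · exact hV.2 x
  · refine (h.mem_iff x _).mpr ⟨?_, ?_⟩
    · exact h.derived_le x (Submodule.subset_span (Or.inr ⟨V, Y, hV, hY, rfl⟩))
    · obtain ⟨δ, -, hδ⟩ := h.exists_transition hW hX hG hV hY
      rw [h0, mul_zero, h.d_eq_neg_val_vfLie hV hY, neg_eq_zero] at hδ
      exact hδ

/-- The function comparing the area form of `D` with the restriction of `dβ` to `D`. -/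
theorem exists_scale [I.Boundaryless] [CompleteSpace E] (h : ReebSplitting D α β T R g) :
    ∃ μ : M → ℝ, SmoothFn I μ ∧ (∀ x, 0 < μ x) ∧
      ∀ W X, IsSection I D W → IsSection I D X → ∀ x, g.gram W X x = (μ x * β.d W X x) ^ 2 := by
  choose W X hW hX hG using h.exists_gram_pos
  have hf : ∀ x, β.d (W x) (X x) x ≠ 0 := fun x => h.d_ne_zero (hW x) (hX x) (hG x).ne'
  let μ : M → ℝ := fun x => √(g.gram (W x) (X x) x / β.d (W x) (X x) x ^ 2)
  have hpos : ∀ x, 0 < g.gram (W x) (X x) x / β.d (W x) (X x) x ^ 2 := fun x =>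
    div_pos (hG x) (sq_pos_of_ne_zero (hf x))
  have hμ : ∀ x, 0 < μ x := fun x => Real.sqrt_pos.mpr (hpos x)
  have heq : ∀ V Y, IsSection I D V → IsSection I D Y → ∀ x,
      g.gram V Y x = (μ x * β.d V Y x) ^ 2 := by
    intro V Y hV hY x
    obtain ⟨δ, hδ, hδ'⟩ := h.exists_transition (hW x) (hX x) (hG x).ne' hV hY
    have := hf x
    rw [hδ, hδ', mul_pow, Real.sq_sqrt (hpos x).le]
    field_simp
  refine ⟨μ, fun x => ?_, hμ, heq⟩
  have hd := β.smooth_d (hW x).1 (hX x).1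
  have hq : ContMDiffAt I 𝓘(ℝ) (⊤ : ℕ∞)
      (fun y => g.gram (W x) (X x) y * (β.d (W x) (X x) y ^ 2)⁻¹) x := by
    have h1 : ContMDiffAt I 𝓘(ℝ) (⊤ : ℕ∞) (fun y => (β.d (W x) (X x) y ^ 2)⁻¹) x := by
      have h2 : ContDiffAt ℝ (⊤ : ℕ∞) (fun t : ℝ => (t ^ 2)⁻¹) (β.d (W x) (X x) x) :=
        (contDiffAt_id.pow 2).inv (pow_ne_zero 2 (hf x))
      exact h2.contMDiffAt.comp x (hd x)
    exact (g.smooth_gram (hW x).1 (hX x).1 x).mul h1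
  have hsqrt := ((Real.contDiffAt_sqrt (hpos x).ne').contMDiffAt (n := (⊤ : ℕ∞))).comp x hq
  refine hsqrt.congr_of_eventuallyEq ?_
  filter_upwards [(ContMDiff.continuous hd).continuousAt.eventually_ne (hf x)] with y hy
  have h3 : g.gram (W x) (X x) y * (β.d (W x) (X x) y ^ 2)⁻¹ = μ y ^ 2 := by
    rw [heq _ _ (hW x) (hX x) y]
    field_simp
  rw [Function.comp_apply, h3, Real.sqrt_sq (hμ y).le]

theorem vderiv_R_val_self [I.Boundaryless] (h : ReebSplitting D α β T R g)
    (hgeo : IsTotallyGeodesic I g D) {U : VF I M} (hU : IsSection I D U) (x : M) :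
    vderiv I R (fun y => g.val y (U y) (U y)) x = 2 * g.val x (vfLie I R U x) (U x) := by
  have h1 := hgeo U hU R h.smoothR h.orthR x
  have h2 : (fun y => g.val y (U y) (R y)) = fun _ => 0 :=
    funext fun y => (g.symm y _ _).trans (h.orthR y _ (hU.2 y))
  have h3 : g.val x (vfLie I U U x) (R x) = 0 := by
    have h4 := congrArg (fun v => g.val x v (R x)) (vfLie_swap U U x)
    simp only [map_neg, LinearMap.neg_apply] at h4
    linarith
  rw [koszul, h2, vderiv_const, h3, vfLie_swap U R, map_neg] at h1
  simp only [LinearMap.neg_apply] at h1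
  linarith

theorem vderiv_R_val [I.Boundaryless] [CompleteSpace E] (h : ReebSplitting D α β T R g)
    (hgeo : IsTotallyGeodesic I g D) {W X : VF I M} (hW : IsSection I D W) (hX : IsSection I D X)
    (x : M) :
    vderiv I R (fun y => g.val y (W y) (X y)) x =
      g.val x (vfLie I R W x) (X x) + g.val x (vfLie I R X x) (W x) := by
  have hWX : IsSection I D (W + X) := ⟨hW.1.add hX.1, fun y => add_mem (hW.2 y) (hX.2 y)⟩
  have hsWW := g.smooth' W W hW.1 hW.1
  have hsWX := g.smooth' W X hW.1 hX.1
  have hsXX := g.smooth' X X hX.1 hX.1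
  have h1 : (fun y => g.val y ((W + X) y) ((W + X) y)) = fun y =>
      (g.val y (W y) (W y) + g.val y (W y) (X y)) +
        (g.val y (W y) (X y) + g.val y (X y) (X y)) := by
    funext y
    simp only [Pi.add_apply, map_add, LinearMap.add_apply, g.symm y (X y) (W y)]
  have h2 : vfLie I R (W + X) x = vfLie I R W x + vfLie I R X x := by
    rw [vfLie_swap, vfLie_add_left R (hW.1.mdifferentiableAt x) (hX.1.mdifferentiableAt x),
      neg_add, ← vfLie_swap, ← vfLie_swap]
  have h3 := h.vderiv_R_val_self hgeo hWX x
  rw [h1, vderiv_add _ ((hsWW.add hsWX).mdifferentiableAt x) ((hsWX.add hsXX).mdifferentiableAt x),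
    vderiv_add _ (hsWW.mdifferentiableAt x) (hsWX.mdifferentiableAt x),
    vderiv_add _ (hsWX.mdifferentiableAt x) (hsXX.mdifferentiableAt x), h2,
    h.vderiv_R_val_self hgeo hW, h.vderiv_R_val_self hgeo hX] at h3
  simp only [Pi.add_apply, map_add, LinearMap.add_apply] at h3
  linarith

theorem vderiv_R_gram [I.Boundaryless] [CompleteSpace E] (h : ReebSplitting D α β T R g)
    (hgeo : IsTotallyGeodesic I g D) {W X : VF I M} (hW : IsSection I D W) (hX : IsSection I D X)
    {x : M} (hG : g.gram W X x ≠ 0) :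
    vderiv I R (g.gram W X) x * β.d W X x =
      2 * g.gram W X x * (vderiv I R (β.d W X) x + β.d W X x * β.d T R x) := by
  have hsWW := g.smooth' W W hW.1 hW.1
  have hsWX := g.smooth' W X hW.1 hX.1
  have hsXX := g.smooth' X X hX.1 hX.1
  obtain ⟨B, hB, hd⟩ := h.exists_bilin β x
  obtain ⟨a, b, hW'⟩ := h.exists_eq hW hX hG h.toIsReebPair (h.mem_iff x) (vfLie I R W x)
  obtain ⟨e, k, hX'⟩ := h.exists_eq hW hX hG h.toIsReebPair (h.mem_iff x) (vfLie I R X x)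
  have hgram : g.gram W X = fun y => g.val y (W y) (W y) * g.val y (X y) (X y) -
      g.val y (W y) (X y) * g.val y (W y) (X y) := funext fun y => by rw [RMetric.gram, sq]
  have hRG : vderiv I R (g.gram W X) x = 2 * (a + k) * g.gram W X x := by
    rw [hgram, vderiv_sub R ((hsWW.mul hsXX).mdifferentiableAt x)
        ((hsWX.mul hsWX).mdifferentiableAt x),
      vderiv_mul R (hsWW.mdifferentiableAt x) (hsXX.mdifferentiableAt x),
      vderiv_mul R (hsWX.mdifferentiableAt x) (hsWX.mdifferentiableAt x),
      h.vderiv_R_val_self hgeo hW, h.vderiv_R_val_self hgeo hX,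
      h.vderiv_R_val hgeo hW hX, hW', hX']
    simp only [map_add, map_smul, LinearMap.add_apply, LinearMap.smul_apply, smul_eq_mul,
      h.orthT x _ (hW.2 x), h.orthT x _ (hX.2 x), h.orthR x _ (hW.2 x), h.orthR x _ (hX.2 x),
      g.symm x (X x) (W x)]
    ring
  have hRf : vderiv I R (β.d W X) x = (a + k) * β.d W X x - β.d W X x * β.d T R x := by
    have hcl := β.d_closed h.smoothR hW.1 hX.1 x
    have e1 : β.d R X = fun _ => 0 := funext fun y => h.d_R_section hX y
    have e2 : β.d R W = fun _ => 0 := funext fun y => h.d_R_section hW y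
    have e3 : ∀ {Y}, IsSection I D Y → B (T x) (Y x) = 0 := fun {Y} hY => by
      rw [← hd _ _ h.smoothT hY.1]
      exact h.d_T_eq_zero hY.1 x ((h.mem_iff x _).mp (hY.2 x)).1
    have e4 : ∀ {Y}, IsSection I D Y → B (R x) (Y x) = 0 := fun {Y} hY => by
      rw [← hd _ _ h.smoothR hY.1]
      exact h.d_R_section hY x
    have e5 : β.d (vfLie I R W) X x = a * β.d W X x := by
      rw [hd _ _ (h.smoothR.vfLie hW.1) hX.1, hW', hd _ _ hW.1 hX.1]
      simp [hB, e3 hX, e4 hX]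
    have e6 : β.d (vfLie I R X) W x = - (k * β.d W X x) := by
      rw [hd _ _ (h.smoothR.vfLie hX.1) hW.1, hX', hd _ _ hW.1 hX.1]
      simp [hB, e3 hW, e4 hW, neg_eq_of_alternating hB (X x) (W x)]
    have e7 : β.d (vfLie I W X) R x = - (β.d W X x * β.d T R x) := by
      rw [β.d_swap, h.d_R (hW.1.vfLie hX.1), h.d_eq_neg_val_vfLie hW hX, β.d_swap T R]
      ring
    rw [e1, e2, vderiv_const, vderiv_const, e5, e6, e7] at hcl
    linarith
  rw [hRG, hRf]
  ring

/-- The function `μ` of `exists_scale` satisfies `R μ = μ dβ(T, R)`. -/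
theorem vderiv_R_scale [I.Boundaryless] [CompleteSpace E] (h : ReebSplitting D α β T R g)
    (hgeo : IsTotallyGeodesic I g D) {μ : M → ℝ} (hμ : SmoothFn I μ) (hpos : ∀ x, 0 < μ x)
    (heq : ∀ W X, IsSection I D W → IsSection I D X → ∀ x,
      g.gram W X x = (μ x * β.d W X x) ^ 2) (x : M) :
    vderiv I R μ x = μ x * β.d T R x := by
  obtain ⟨W, X, hW, hX, hG⟩ := h.exists_gram_pos x
  have hf := h.d_ne_zero hW hX hG.ne'
  have hd := β.smooth_d hW.1 hX.1
  have hgram : g.gram W X = fun y => (μ y * β.d W X y) * (μ y * β.d W X y) :=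
    funext fun y => by rw [heq W X hW hX, sq]
  have h1 := h.vderiv_R_gram hgeo hW hX hG.ne'
  have h2 := (hμ.mul hd).mdifferentiableAt x
  rw [hgram, vderiv_mul R h2 h2, vderiv_mul R (hμ.mdifferentiableAt x)
    (hd.mdifferentiableAt x)] at h1
  have h3 : 2 * μ x * β.d W X x ^ 3 ≠ 0 :=
    mul_ne_zero (mul_ne_zero two_ne_zero (hpos x).ne') (pow_ne_zero 3 hf)
  refine mul_left_cancel₀ h3 ?_
  linear_combination h1

theorem d_scale_R [I.Boundaryless] (h : ReebSplitting D α β T R g) {μ : M → ℝ}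
    (hμ : SmoothFn I μ) (hRμ : ∀ x, vderiv I R μ x = μ x * β.d T R x) {Y : VF I M}
    (hY : SmoothVF I Y) (x : M) : (β.scale hμ).d R Y x = 0 := by
  rw [β.d_scale hμ h.smoothR hY, h.betaR, h.d_R hY, hRμ, β.d_swap R T]
  ring

theorem formSqZero_scale [I.Boundaryless] [CompleteSpace E] (h : ReebSplitting D α β T R g)
    {μ : M → ℝ} (hμ : SmoothFn I μ) (hRμ : ∀ x, vderiv I R μ x = μ x * β.d T R x) :
    FormSqZero I (β.scale hμ).d := by
  intro V₀ V₁ V₂ V₃ h₀ h₁ h₂ h₃ x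
  obtain ⟨W, X, hW, hX, hG⟩ := h.exists_gram_pos x
  obtain ⟨B, hB, hd⟩ := h.exists_bilin (β.scale hμ) x
  have hgen : ∀ v, ∃ p q b a : ℝ, v = p • W x + q • X x + b • T x + a • R x := fun v => by
    obtain ⟨p, q, hv⟩ := h.exists_eq hW hX hG.ne' h.toIsReebPair (h.mem_iff x) v
    exact ⟨p, q, _, _, hv⟩
  have hr : ∀ {Y}, SmoothVF I Y → B (R x) (Y x) = 0 := fun {Y} hY => by
    rw [← hd _ _ h.smoothR hY, h.d_scale_R hμ hRμ hY]
  have hr' : ∀ v, B (R x) v = 0 := fun v => by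
    obtain ⟨p, q, b, a, rfl⟩ := hgen v
    simp [hr hW.1, hr hX.1, hr h.smoothT, hr h.smoothR]
  simp only [hd _ _ h₀ h₁, hd _ _ h₀ h₂, hd _ _ h₀ h₃, hd _ _ h₁ h₂, hd _ _ h₁ h₃,
    hd _ _ h₂ h₃]
  exact alternating_sq_eq_zero hB hr' hgen _ _ _ _

theorem isIntegrableDist_reebDist [I.Boundaryless] [CompleteSpace E]
    (h : ReebSplitting D α β T R g) {μ : M → ℝ} (hμ : SmoothFn I μ) (hμ0 : ∀ x, μ x ≠ 0)
    (hRμ : ∀ x, vderiv I R μ x = μ x * β.d T R x) {T' R' : VF I M}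
    (h' : IsReebPair I α (β.scale hμ) T' R') : IsIntegrableDist I (reebDist I T' R') := by
  set θ := β.scale hμ
  have hmem : ∀ x v, v ∈ D x ↔ α.val x v = 0 ∧ θ.val x v = 0 := fun x v => by
    have e : θ.val x v = μ x * β.val x v := rfl
    rw [h.mem_iff, e, mul_eq_zero, or_iff_right (hμ0 x)]
  have hne : ∀ {W X : VF I M} {x}, IsSection I D W → IsSection I D X → g.gram W X x ≠ 0 →
      θ.d W X x ≠ 0 := by
    intro W X x hW hX hG
    rw [β.d_scale hμ hW.1 hX.1, ((h.mem_iff x _).mp (hW.2 x)).2,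
      ((h.mem_iff x _).mp (hX.2 x)).2, mul_zero, mul_zero, sub_self, zero_add]
    exact mul_ne_zero (hμ0 x) (h.d_ne_zero hW hX hG)
  have hT : ∀ {W : VF I M}, IsSection I D W → ∀ x, θ.d T' W x = 0 := fun hW x =>
    h'.d_T_eq_zero hW.1 x ((h.mem_iff x _).mp (hW.2 x)).1
  have hR : ∀ {W : VF I M}, IsSection I D W → ∀ x, θ.d R' W x = 0 := fun hW x => by
    rw [h'.d_R hW.1, ((hmem x _).mp (hW.2 x)).2, zero_mul]
  have hTR : ∀ x, θ.d T' R' x = 0 := fun x => by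
    obtain ⟨W, X, hW, hX, hG⟩ := h.exists_gram_pos x
    have h1 := h.formSqZero_scale hμ hRμ T' R' W X h'.smoothT h'.smoothR hW.1 hX.1 x
    rw [hT hW, hT hX, zero_mul, zero_mul, sub_zero, add_zero] at h1
    exact (mul_eq_zero.mp h1).resolve_right (hne hW hX hG.ne')
  have hker : ∀ {V Y : VF I M}, IsSection I (reebDist I T' R') V → SmoothVF I Y →
      ∀ x, θ.d V Y x = 0 := by
    intro V Y hV hY x
    obtain ⟨W, X, hW, hX, hG⟩ := h.exists_gram_pos x
    obtain ⟨B, hB, hd⟩ := h.exists_bilin θ x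
    obtain ⟨b, a, hba⟩ := Submodule.mem_span_pair.mp (hV.2 x)
    obtain ⟨p, q, hpq⟩ := h.exists_eq hW hX hG.ne' h' (hmem x) (Y x)
    have e := hTR x
    rw [hd _ _ h'.smoothT h'.smoothR] at e
    have eW := And.intro (hT hW x) (hR hW x)
    have eX := And.intro (hT hX x) (hR hX x)
    rw [hd _ _ h'.smoothT hW.1, hd _ _ h'.smoothR hW.1] at eW
    rw [hd _ _ h'.smoothT hX.1, hd _ _ h'.smoothR hX.1] at eX
    rw [hd _ _ hV.1 hY, ← hba, hpq]
    simp [hB, e, eW, eX, neg_eq_of_alternating hB (R' x) (T' x)]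
  intro V Y hV hY x
  obtain ⟨W, X, hW, hX, hG⟩ := h.exists_gram_pos x
  obtain ⟨B, hB, hd⟩ := h.exists_bilin θ x
  have hVY := hV.1.vfLie hY.1
  have hbr : ∀ {Z : VF I M}, IsSection I D Z → B (vfLie I V Y x) (Z x) = 0 := by
    intro Z hZ
    have e1 : θ.d Y Z = fun _ => 0 := funext (hker hY hZ.1)
    have e2 : θ.d V Z = fun _ => 0 := funext (hker hV hZ.1)
    have e3 : θ.d V Y = fun _ => 0 := funext (hker hV hY.1)
    have hcl := θ.d_closed hV.1 hY.1 hZ.1 x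
    rw [e1, e2, e3, vderiv_const, vderiv_const, vderiv_const, θ.d_swap (vfLie I V Z) Y,
      θ.d_swap (vfLie I Y Z) V, hker hY (hV.1.vfLie hZ.1), hker hV (hY.1.vfLie hZ.1),
      hd _ _ hVY hZ.1] at hcl
    linarith
  obtain ⟨p, q, hpq⟩ := h.exists_eq hW hX hG.ne' h' (hmem x) (vfLie I V Y x)
  have hf := hne hW hX hG.ne'
  rw [hd _ _ hW.1 hX.1] at hf
  have eT : ∀ {Z : VF I M}, IsSection I D Z → B (T' x) (Z x) = 0 := fun hZ => by
    rw [← hd _ _ h'.smoothT hZ.1, hT hZ]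
  have eR : ∀ {Z : VF I M}, IsSection I D Z → B (R' x) (Z x) = 0 := fun hZ => by
    rw [← hd _ _ h'.smoothR hZ.1, hR hZ]
  have hp := hbr hX
  have hq := hbr hW
  rw [hpq] at hp hq
  simp only [map_add, map_smul, LinearMap.add_apply, LinearMap.smul_apply, smul_eq_mul, hB,
    eT hX, eR hX, eT hW, eR hW, mul_zero, add_zero, zero_add,
    neg_eq_of_alternating hB (X x) (W x), mul_neg, neg_eq_zero] at hp hq
  rw [(mul_eq_zero.mp hp).resolve_right hf, (mul_eq_zero.mp hq).resolve_right hf, zero_smul,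
    zero_smul, zero_add, zero_add] at hpq
  exact Submodule.mem_span_pair.mpr ⟨_, _, hpq.symm⟩

end ReebSplitting

/-- The Engel condition provides the splitting. -/
theorem IsEngel.reebSplitting [I.Boundaryless] [CompleteSpace E] (hD : IsEngel I D)
    (hforms : EngelDefiningForms I D α β) (hTR : IsReebPair I α β T R)
    (hperp : ∀ x v, v ∈ reebDist I T R x ↔ ∀ u ∈ D x, g.val x v u = 0) :
    ReebSplitting D α β T R g where
  toIsReebPair := hTR
  mem_iff x v := by
    rw [hforms.1 x]
    simp
  finrank_eq := hD.1
  orthT x := (hperp x _).mp (Submodule.subset_span (by simp))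
  orthR x := (hperp x _).mp (Submodule.subset_span (by simp))
  derived_le x := (hforms.2 x).le
  not_derived_le x hle := by
    have h2 := hD.1 x
    have h3 := hD.2.1 x
    have : FiniteDimensional ℝ (D x) := FiniteDimensional.of_finrank_pos (by omega)
    have := Submodule.finrank_mono hle
    omega
  span_smooth x := by
    rw [eq_top_iff, ← hD.2.2 x]
    refine Submodule.span_mono ?_
    rintro _ (⟨V, hV, rfl⟩ | ⟨V, W, hV, hW, rfl⟩)
    · exact ⟨V, hV.1, rfl⟩
    · exact ⟨_, hV.1.vfLie hW.1, rfl⟩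

theorem EngelDefiningForms.scale (hforms : EngelDefiningForms I D α β) {μ : M → ℝ}
    (hμ : SmoothFn I μ) (hμ0 : ∀ x, μ x ≠ 0) : EngelDefiningForms I D α (β.scale hμ) := by
  refine ⟨fun x => ?_, hforms.2⟩
  rw [hforms.1 x]
  exact congrArg _ (LinearMap.ker_smul (β.val x) (μ x) (hμ0 x)).symm

end Splitting

/-- Let `D = ker α∧β` be Engel and `g` a metric with `D ⊥ = 𝓡`.  If `D`
is totally geodesic, then there is a nowhere vanishing smooth function `μ` such that
`β̃ = μβ` satisfies `dβ̃ ∧ dβ̃ = 0`; in particular the Reeb distribution `𝓡̃` associated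
with the Engel defining forms `α` and `β̃` is integrable. -/
theorem totally_geodesic_implies_integrable_reeb {M : Type*} [TopologicalSpace M]
    [ChartedSpace (EuclideanSpace ℝ (Fin 4)) M] [IsManifold (𝓡 4) (⊤ : ℕ∞) M]
    (D : TangentDist (𝓡 4) M) (α β : OneForm (𝓡 4) M)
    (hD : IsEngel (𝓡 4) D) (hforms : EngelDefiningForms (𝓡 4) D α β)
    (T R : VF (𝓡 4) M) (hTR : IsReebPair (𝓡 4) α β T R)
    (g : RMetric (𝓡 4) M)
    (hperp : ∀ x v, v ∈ reebDist (𝓡 4) T R x ↔ ∀ u ∈ D x, g.val x v u = 0)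
    (hgeo : IsTotallyGeodesic (𝓡 4) g D) :
    ∃ μ : M → ℝ, SmoothFn (𝓡 4) μ ∧ (∀ x, μ x ≠ 0) ∧
      ∃ βt : OneForm (𝓡 4) M, (∀ x, βt.val x = μ x • β.val x) ∧
        EngelDefiningForms (𝓡 4) D α βt ∧ FormSqZero (𝓡 4) βt.d ∧
        ∀ T' R', IsReebPair (𝓡 4) α βt T' R' →
          IsIntegrableDist (𝓡 4) (reebDist (𝓡 4) T' R') := by
  have h := hD.reebSplitting hforms hTR hperp
  obtain ⟨μ, hμ, hpos, heq⟩ := h.exists_scale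
  have hRμ := h.vderiv_R_scale hgeo hμ hpos heq
  have hμ0 : ∀ x, μ x ≠ 0 := fun x => (hpos x).ne'
  exact ⟨μ, hμ, hμ0, β.scale hμ, fun _ => rfl, hforms.scale hμ hμ0, h.formSqZero_scale hμ hRμ,
    fun _ _ h' => h.isIntegrableDist_reebDist hμ hμ0 hRμ h'⟩

end
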